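/- Let n be a prime and let X be a nonempty proper subset of ℤ_n. Then X is an arithmetic progression in ℤ_n if and only if there exists an element l ∈ ℤ_n such that |(X + l) ∖ X| = 1. -/

import Mathlib

open scoped BigOperators

/-- `X ⊆ ℤ_n` is an arithmetic progression. -/
def IsAP (n : ℕ) (X : Finset (ZMod n)) : Prop :=
  ∃ a d : ZMod n, X = (Finset.range X.card).image (fun i : ℕ => a + (i : ZMod n) * d)

/-- Modulo a prime, the terms `a + i * d` with `i < n` and `d ≠ 0` are pairwise distinct. -/
theorem ZMod.add_natCast_mul_injOn {n : ℕ} (hn : n.Prime) (a : ZMod n) {d : ZMod n} (hd : d ≠ 0) :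
    Set.InjOn (fun i : ℕ => a + (i : ZMod n) * d) {i | i < n} := by
  have : Fact n.Prime := ⟨hn⟩
  intro i hi j hj hij
  have h : (i : ZMod n) = j := mul_right_cancel₀ hd (add_left_cancel hij)
  rw [ZMod.natCast_eq_natCast_iff'] at h
  rwa [Nat.mod_eq_of_lt hi, Nat.mod_eq_of_lt hj] at h

/-- Modulo a prime, an arithmetic progression has a presentation with nonzero difference. -/
theorem IsAP.exists_ne_zero {n : ℕ} (hn : n.Prime) {X : Finset (ZMod n)} (hX : X.Nonempty)
    (h : IsAP n X) :
    ∃ a d : ZMod n, d ≠ 0 ∧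
      X = (Finset.range X.card).image (fun i : ℕ => a + (i : ZMod n) * d) := by
  have : Fact n.Prime := ⟨hn⟩
  obtain ⟨a, d, h⟩ := h
  by_cases hd : d = 0
  · have hXa : X = {a} := by
      refine (Finset.Nonempty.subset_singleton_iff hX).1 ?_
      rw [h, hd]
      intro x hx
      obtain ⟨i, -, rfl⟩ := Finset.mem_image.1 hx
      simp
    exact ⟨a, 1, one_ne_zero, by simp [hXa]⟩
  · exact ⟨a, d, hd, h⟩

/-- A proper progression modulo a prime gains exactly one element when shifted by its
difference. -/
theorem card_shift_sdiff_of_eq_image {n : ℕ} [NeZero n] (hn : n.Prime) {X : Finset (ZMod n)}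
    (hX : X.Nonempty) (hXU : X ≠ Finset.univ) {a d : ZMod n} (hd : d ≠ 0)
    (h : X = (Finset.range X.card).image (fun i : ℕ => a + (i : ZMod n) * d)) :
    ((X.image (fun x => x + d)) \ X).card = 1 := by
  have hlt : X.card < n := by
    simpa [ZMod.card] using (Finset.card_lt_iff_ne_univ X).2 hXU
  have hpos := hX.card_pos
  have hmem (x : ZMod n) : x ∈ X ↔ ∃ i < X.card, a + (i : ZMod n) * d = x := by
    conv_lhs => rw [h]
    simp
  rw [Finset.card_eq_one]
  refine ⟨a + (X.card : ZMod n) * d, ?_⟩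
  ext y
  rw [Finset.mem_sdiff, Finset.mem_image, Finset.mem_singleton]
  constructor
  · rintro ⟨⟨x, hx, rfl⟩, hy⟩
    obtain ⟨i, hi, rfl⟩ := (hmem x).1 hx
    have hi' : i + 1 = X.card := by
      by_contra hne
      exact hy ((hmem _).2 ⟨i + 1, by omega, by push_cast; ring⟩)
    rw [← hi']
    push_cast
    ring
  · rintro rfl
    refine ⟨⟨a + ((X.card - 1 : ℕ) : ZMod n) * d, (hmem _).2 ⟨_, by omega, rfl⟩, ?_⟩, ?_⟩
    · rw [Nat.cast_pred hpos]
      ring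
    · intro hy
      obtain ⟨i, hi, hia⟩ := (hmem _).1 hy
      exact hi.ne (ZMod.add_natCast_mul_injOn hn a hd (hi.trans hlt) hlt hia)

/-- A set modulo a prime that gains exactly one element under some shift is an arithmetic
progression. -/
theorem isAP_of_card_shift_sdiff {n : ℕ} [NeZero n] (hn : n.Prime) {X : Finset (ZMod n)}
    {l : ZMod n} (h : ((X.image (fun x => x + l)) \ X).card = 1) : IsAP n X := by
  have : Fact n.Prime := ⟨hn⟩
  have hl : l ≠ 0 := by
    rintro rfl
    simp at h
  have hcard : (X.image (fun x => x + l)).card = X.card :=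
    Finset.card_image_of_injective _ (add_left_injective l)
  rw [Finset.card_sdiff_comm hcard, Finset.card_eq_one] at h
  obtain ⟨a, ha⟩ := h
  have hpred (x : ZMod n) (hx : x + l ∈ X) (hxa : x + l ≠ a) : x ∈ X := by
    by_contra hxX
    refine hxa (Finset.mem_singleton.1 (ha ▸ Finset.mem_sdiff.2 ⟨hx, fun hm => hxX ?_⟩))
    obtain ⟨y, hy, hyx⟩ := Finset.mem_image.1 hm
    exact add_right_cancel hyx ▸ hy
  have hinj := ZMod.add_natCast_mul_injOn hn a hl
  have hdown (j : ℕ) (hj : j < n) (hjX : a + (j : ZMod n) * l ∈ X) :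
      ∀ i ≤ j, a + (i : ZMod n) * l ∈ X := by
    intro i hi
    induction hi using Nat.decreasingInduction with
    | self => exact hjX
    | of_succ k hk ih =>
      have hsucc : a + (k : ZMod n) * l + l = a + ((k + 1 : ℕ) : ZMod n) * l := by
        push_cast
        ring
      refine hpred _ (hsucc ▸ ih) fun hka => ?_
      have hk0 : k + 1 = 0 :=
        hinj (show k + 1 < n by omega) hn.pos (by simpa using hsucc.symm.trans hka)
      omega
  refine ⟨a, l, Finset.eq_of_subset_of_card_le (fun x hx => ?_)
    (Finset.card_image_le.trans_eq (Finset.card_range _))⟩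
  have hxj : a + ((((x - a) / l).val : ℕ) : ZMod n) * l = x := by
    rw [ZMod.natCast_zmod_val, div_mul_cancel₀ _ hl, add_sub_cancel]
  have hj : ((x - a) / l).val < n := ZMod.val_lt _
  generalize ((x - a) / l).val = j at hxj hj
  refine Finset.mem_image.2 ⟨j, Finset.mem_range.2 ?_, hxj⟩
  have hsub : (Finset.range (j + 1)).image (fun i : ℕ => a + (i : ZMod n) * l) ⊆ X := by
    intro y hy
    obtain ⟨i, hi, rfl⟩ := Finset.mem_image.1 hy
    exact hdown j hj (hxj ▸ hx) i (Nat.lt_succ_iff.1 (Finset.mem_range.1 hi))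
  have hle := Finset.card_le_card hsub
  rw [Finset.card_image_of_injOn (hinj.mono fun i hi => ?_), Finset.card_range] at hle
  · exact hle
  · exact (Nat.lt_succ_iff.1 (Finset.mem_range.1 hi)).trans_lt hj

/-- For `n` prime and `X` a nonempty proper subset of `ℤ_n`, `X` is an
arithmetic progression iff there is an `l ∈ ℤ_n` with `|(X + l) ∖ X| = 1`. -/
theorem ap_iff_shift_almost_invariant (n : ℕ) [NeZero n] (hn : n.Prime)
    (X : Finset (ZMod n)) (hX : X.Nonempty) (hXU : X ≠ Finset.univ) :
    IsAP n X ↔ ∃ l : ZMod n, ((X.image (fun x => x + l)) \ X).card = 1 := by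
  constructor
  · intro h
    obtain ⟨a, d, hd, h⟩ := h.exists_ne_zero hn hX
    exact ⟨d, card_shift_sdiff_of_eq_image hn hX hXU hd h⟩
  · rintro ⟨l, h⟩
    exact isAP_of_card_shift_sdiff hn h
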